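/- Let k ≥ 1 and m ≥ 1 be integers. Write ℝ^{2k+m+1} = ℝ^{2k+1} ⊕ ℝ^m and, for a real skew-symmetric (2k+m+1) × (2k+m+1) matrix A and b ∈ ℝ^{2k+m+1}, consider the condition (★): the ℝ^m-component of A(x', 0) − ⟨b, (x', 0)⟩ (x', 0) + b vanishes for every unit vector x' ∈ ℝ^{2k+1}. Then (★) holds if and only if the off-diagonal block of A (i.e., the entries A_{ij} with i ≤ 2k+1 < j or j ≤ 2k+1 < i) vanishes and the ℝ^m-component of b vanishes. Consequently, the linear map sending (A, b) ∈ 𝔰𝔬(2k+m+1) × ℝ^{2k+m+1} to the function x' ↦ (ℝ^m-component of A(x',0) − ⟨b,(x',0)⟩(x',0) + b) on the unit sphere of ℝ^{2k+1} has kernel of dimension (k+1)(2k+1) + m(m−1)/2 and rank 2(k+1)m. -/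

import Mathlib

open Matrix

/-- The conformal vector field on the sphere associated to `(A, b)`:
`x ↦ Ax − ⟨b, x⟩x + b`. -/
def confField {ι : Type} [Fintype ι] (A : Matrix ι ι ℝ) (b : ι → ℝ) (x : ι → ℝ) : ι → ℝ :=
  A.mulVec x - (b ⬝ᵥ x) • x + b

/-- The embedding `ℝ^{2k+1} → ℝ^{2k+1} ⊕ ℝ^m`, `x' ↦ (x', 0)`. -/
def embedVec (k m : ℕ) (x' : Fin (2 * k + 1) → ℝ) : (Fin (2 * k + 1) ⊕ Fin m) → ℝ :=
  Sum.elim x' 0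

/-- The space of pairs `(A, b)` with `A` a skew-symmetric matrix and `b` a vector,
realizing `𝔰𝔬(ι) ⊕ ℝ^ι ≅ 𝔰𝔬(ι ⊕ ℝ, 1)`. -/
def skewPairs (ι : Type) [Fintype ι] [DecidableEq ι] :
    Submodule ℝ (Matrix ι ι ℝ × (ι → ℝ)) where
  carrier := {p | p.1ᵀ = -p.1}
  add_mem' := by
    intro p q hp hq
    simp only [Set.mem_setOf_eq] at *
    simp only [Prod.fst_add, Matrix.transpose_add, hp, hq]
    abel
  zero_mem' := by simp
  smul_mem' := by
    intro c p hp
    simp only [Set.mem_setOf_eq] at *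
    simp [Matrix.transpose_smul, hp]

/-- The restriction-projection map: a pair `(A, b)` (a conformal vector field
`x ↦ Ax − ⟨b,x⟩x + b` on `S^{2k+m}(1)`) is sent to the `ℝ^m`-component of its value at
points `(x', 0)` of the totally geodesic `S^{2k}`. -/
noncomputable def restrictionProjection (k m : ℕ) :
    skewPairs (Fin (2 * k + 1) ⊕ Fin m) →ₗ[ℝ]
      ({x' : EuclideanSpace ℝ (Fin (2 * k + 1)) // ‖x'‖ = 1} → (Fin m → ℝ)) where
  toFun p := fun x' j => confField p.1.1 p.1.2 (embedVec k m x'.1) (Sum.inr j)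
  map_add' p q := by
    funext x' j
    simp only [Submodule.coe_add, confField, Prod.fst_add, Prod.snd_add, Matrix.add_mulVec,
      add_dotProduct, add_smul, Pi.add_apply, Pi.sub_apply, Pi.smul_apply,
      smul_eq_mul]
    ring
  map_smul' t p := by
    funext x' j
    simp only [Submodule.coe_smul, confField, Prod.smul_fst, Prod.smul_snd, Matrix.smul_mulVec,
      smul_dotProduct, Pi.add_apply, Pi.sub_apply, Pi.smul_apply, smul_eq_mul,
      RingHom.id_apply]
    ring
  
/-- At `(x', 0)` the quadratic term is tangential, so the normal part of the conformal field
is affine in `x'`. -/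
lemma confField_embedVec_inr {k m : ℕ}
    (A : Matrix (Fin (2 * k + 1) ⊕ Fin m) (Fin (2 * k + 1) ⊕ Fin m) ℝ)
    (b : (Fin (2 * k + 1) ⊕ Fin m) → ℝ) (x : Fin (2 * k + 1) → ℝ) (j : Fin m) :
    confField A b (embedVec k m x) (Sum.inr j) =
      ∑ i, A (Sum.inr j) (Sum.inl i) * x i + b (Sum.inr j) := by
  simp [confField, embedVec, Matrix.mulVec, dotProduct]

lemma eq_zero_of_affine_eq_zero_on_unit_sphere {n : Type*} [Fintype n] [DecidableEq n] [Nonempty n]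
    (a : n → ℝ) (c : ℝ) (h : ∀ x : EuclideanSpace ℝ n, ‖x‖ = 1 → ∑ i, a i * x i + c = 0) :
    (∀ i, a i = 0) ∧ c = 0 := by
  have key (i : n) : a i = 0 ∧ c = 0 := by
    have h₁ := h (EuclideanSpace.single i 1) (by simp)
    have h₂ := h (EuclideanSpace.single i (-1)) (by simp)
    simp at h₁ h₂
    constructor <;> linarith
  exact ⟨fun i => (key i).1, (key (Classical.arbitrary n)).2⟩

/-- A skew-symmetric matrix together with a vector amounts to a function on the pairs `i ≤ j`:
the matrix fills the pairs `i < j`, the vector fills the diagonal. -/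
noncomputable def skewPairsEquiv (ι : Type) [Fintype ι] [DecidableEq ι] [LinearOrder ι] :
    skewPairs ι ≃ₗ[ℝ] ({p : ι × ι // p.1 ≤ p.2} → ℝ) where
  toFun q p := if p.1.1 < p.1.2 then q.1.1 p.1.1 p.1.2 else q.1.2 p.1.1
  map_add' q r := by
    funext p
    by_cases h : p.1.1 < p.1.2 <;> simp [h]
  map_smul' t q := by
    funext p
    by_cases h : p.1.1 < p.1.2 <;> simp [h]
  invFun f :=
    ⟨(Matrix.of fun i j =>
        if h : i < j then f ⟨(i, j), h.le⟩ else if h : j < i then -f ⟨(j, i), h.le⟩ else 0,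
      fun i => f ⟨(i, i), le_rfl⟩), by
      ext i j
      rcases lt_trichotomy i j with h | rfl | h <;> simp [*, not_lt_of_gt]⟩
  left_inv q := by
    obtain ⟨⟨A, b⟩, hA⟩ := q
    have hA (i j : ι) : A j i = -A i j := congrFun (congrFun hA i) j
    ext i j
    · rcases lt_trichotomy i j with h | rfl | h
      · simp [h]
      · have := hA i i
        simp
        linarith
      · simp [h, not_lt_of_gt, hA i j]
    · simp
  right_inv f := by
    funext ⟨⟨i, j⟩, hij⟩
    rcases (show i ≤ j from hij).lt_or_eq with h | rfl
    · simp [h]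
    · simp

lemma finrank_skewPairs (ι : Type) [Fintype ι] [DecidableEq ι] :
    Module.finrank ℝ (skewPairs ι) = (Fintype.card ι + 1).choose 2 := by
  let : LinearOrder ι := LinearOrder.lift' (Fintype.equivFin ι) (Fintype.equivFin ι).injective
  rw [(skewPairsEquiv ι).finrank_eq, Module.finrank_fintype_fun_eq_card,
    ← Fintype.card_congr Sym2.sortEquiv, Sym2.card]

/-- The part of `(A, b)` that the restriction-projection map sees: the lower off-diagonal block
of `A` and the normal component of `b`. -/
def normalPart (k m : ℕ) : skewPairs (Fin (2 * k + 1) ⊕ Fin m) →ₗ[ℝ]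
    (Fin m → Fin (2 * k + 1) → ℝ) × (Fin m → ℝ) where
  toFun q := (fun j i => q.1.1 (Sum.inr j) (Sum.inl i), fun j => q.1.2 (Sum.inr j))
  map_add' _ _ := rfl
  map_smul' _ _ := rfl

lemma normalPart_surjective (k m : ℕ) : Function.Surjective (normalPart k m) := by
  rintro ⟨B, c⟩
  refine ⟨⟨(Matrix.fromBlocks 0 (-(Matrix.of B)ᵀ) (Matrix.of B) 0, Sum.elim 0 c), ?_⟩, rfl⟩
  change _ᵀ = -_
  simp [Matrix.fromBlocks_transpose, Matrix.fromBlocks_neg]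

lemma ker_restrictionProjection (k m : ℕ) :
    LinearMap.ker (restrictionProjection k m) = LinearMap.ker (normalPart k m) := by
  ext q
  have hr : restrictionProjection k m q = 0 ↔
      ∀ x : EuclideanSpace ℝ (Fin (2 * k + 1)), ‖x‖ = 1 → ∀ j : Fin m,
        ∑ i, q.1.1 (Sum.inr j) (Sum.inl i) * x i + q.1.2 (Sum.inr j) = 0 := by
    simp [funext_iff, restrictionProjection, confField_embedVec_inr]
  have hn : normalPart k m q = 0 ↔
      (∀ j i, q.1.1 (Sum.inr j) (Sum.inl i) = 0) ∧ ∀ j, q.1.2 (Sum.inr j) = 0 := by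
    simp only [Prod.ext_iff, funext_iff]
    rfl
  rw [LinearMap.mem_ker, LinearMap.mem_ker, hr, hn]
  constructor
  · intro h
    have key (j : Fin m) := eq_zero_of_affine_eq_zero_on_unit_sphere _ _ fun x hx => h x hx j
    exact ⟨fun j => (key j).1, fun j => (key j).2⟩
  · rintro ⟨hA, hb⟩ x - j
    simp [hA, hb]

lemma finrank_range_restrictionProjection (k m : ℕ) :
    Module.finrank ℝ (LinearMap.range (restrictionProjection k m)) = 2 * (k + 1) * m := by
  rw [← (restrictionProjection k m).quotKerEquivRange.finrank_eq, ker_restrictionProjection,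
    ((normalPart k m).quotKerEquivOfSurjective (normalPart_surjective k m)).finrank_eq]
  simp [Module.finrank_pi_fintype]
  ring

lemma finrank_ker_restrictionProjection (k m : ℕ) :
    Module.finrank ℝ (LinearMap.ker (restrictionProjection k m)) =
      (k + 1) * (2 * k + 1) + m * (m - 1) / 2 := by
  have h := (restrictionProjection k m).finrank_range_add_finrank_ker
  rw [finrank_range_restrictionProjection, finrank_skewPairs, Fintype.card_sum, Fintype.card_fin,
    Fintype.card_fin] at h
  have hsplit : (2 * k + 1 + m + 1).choose 2 =
      2 * (k + 1) * m + ((k + 1) * (2 * k + 1) + m.choose 2) := by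
    rw [show 2 * k + 1 + m + 1 = (2 * k + 2) + m by ring, Nat.add_choose_eq,
      Finset.Nat.antidiagonal_succ]
    simp [Finset.Nat.antidiagonal_succ, Nat.choose_two_right]
    rw [show (2 * k + 2) * (2 * k + 1) = 2 * ((k + 1) * (2 * k + 1)) by ring,
      Nat.mul_div_cancel_left _ two_pos]
    ring
  rw [hsplit] at h
  rw [← Nat.choose_two_right]
  exact Nat.add_left_cancel h

/-- For the totally geodesic `S^{2k} ⊂ S^{2k+m}(1)`: the condition (★) that the
`ℝ^m`-component of `A(x',0) − ⟨b,(x',0)⟩(x',0) + b` vanishes for every unit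
`x' ∈ ℝ^{2k+1}` holds iff the off-diagonal block of `A` and the `ℝ^m`-component of `b`
vanish; consequently the restriction-projection map has kernel of dimension
`(k+1)(2k+1) + m(m−1)/2` and rank `2(k+1)m`. -/
theorem restrictionProjection_kernel_and_rank (k m : ℕ) (hk : 1 ≤ k) (hm : 1 ≤ m) :
    (∀ (A : Matrix (Fin (2 * k + 1) ⊕ Fin m) (Fin (2 * k + 1) ⊕ Fin m) ℝ)
        (b : (Fin (2 * k + 1) ⊕ Fin m) → ℝ), Aᵀ = -A →
      ((∀ x' : EuclideanSpace ℝ (Fin (2 * k + 1)), ‖x'‖ = 1 → ∀ j : Fin m,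
          confField A b (embedVec k m x') (Sum.inr j) = 0)
        ↔ ((∀ (i : Fin (2 * k + 1)) (j : Fin m),
              A (Sum.inl i) (Sum.inr j) = 0 ∧ A (Sum.inr j) (Sum.inl i) = 0)
            ∧ ∀ j : Fin m, b (Sum.inr j) = 0))) ∧
    Module.finrank ℝ (LinearMap.ker (restrictionProjection k m))
      = (k + 1) * (2 * k + 1) + m * (m - 1) / 2 ∧
    Module.finrank ℝ (LinearMap.range (restrictionProjection k m)) = 2 * (k + 1) * m := by
  refine ⟨fun A b hA => ?_, finrank_ker_restrictionProjection k m,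
    finrank_range_restrictionProjection k m⟩
  have hA (p q) : A q p = -A p q := congrFun (congrFun hA p) q
  simp only [confField_embedVec_inr]
  constructor
  · intro h
    have key (j : Fin m) := eq_zero_of_affine_eq_zero_on_unit_sphere _ _ fun x hx => h x hx j
    exact ⟨fun i j => ⟨by rw [hA, (key j).1 i, neg_zero], (key j).1 i⟩, fun j => (key j).2⟩
  · rintro ⟨hoff, hb⟩ x - j
    simp [hoff, hb]
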